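/- Let 𝔊_TY = (B, Δ, S, ε) be the Tambara–Yamagami weak Hopf *-algebra attached to (G, χ, τ). For a subgroup L ≤ G set v^0_Y := Σ_{y∈Y} v^0_y for Y ∈ G/L, L^⊥ := {g ∈ G : χ(g,l) = 1 for all l ∈ L}, and I^L := span{ v^0_Y : Y ∈ G/L } ⊗ conj(H^0) + Σ_{l∈L^⊥} ℂ v^l_m ⊗ conj(H^l) ⊆ B. Then each I^L is an invariant coideal of 𝔊_TY, and so is B_s = ε_s(B) (denoted I^Ω). -/

import Mathlib

open scoped TensorProduct

noncomputable section

open scoped Classical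

section TY

variable (G : Type) [AddCommGroup G] [Fintype G] [DecidableEq G]

/-- The index set `Ω = G ⊔ {m}` of the set of simple objects. -/
abbrev ΩIdx := G ⊕ Unit

/-- The index set `G ⊔ Ḡ` of the basis of `H^m`. -/
abbrev MIdx := G ⊕ G

/-- The basis index set of `V = ⊕_{x ∈ Ω} H^x`: `inl (g, y)` is `v^g_y` (`y ∈ Ω`),
`inr (inl k)` is `v^m_k` and `inr (inr k)` is `v^m_{k̄}`. -/
abbrev VIdx := (G × ΩIdx G) ⊕ MIdx G

/-- The tyGrade (`∈ Ω`) of a basis vector of `V`. -/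
def tyGrade : VIdx G → ΩIdx G
  | Sum.inl (g, _) => Sum.inl g
  | Sum.inr _ => Sum.inr ()

/-- `V = ⊕_{x ∈ Ω} H^x`, as coordinate functions. -/
abbrev TYV := VIdx G → ℂ

/-- Basis index set of `B = ⊕_{x ∈ Ω} H^x ⊗ conj(H^x)`: pairs of equal tyGrade;
the pair `(α, β)` of tyGrade `x` encodes `f^x_{α,β} = v^x_α ⊗ conj (v^x_β)`. -/
abbrev BIdx := {p : VIdx G × VIdx G // tyGrade G p.1 = tyGrade G p.2}

/-- The underlying space of the Tambara–Yamagami weak Hopf `*`-algebra. -/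
abbrev TYB := BIdx G → ℂ

/-- Structure constants of the multiplication `∘` on `V`:
`circC χ τ a b c` is the coefficient of the basis vector `c` in `(basis a) ∘ (basis b)`. -/
def circC (χ : G → G → ℂ) (τ : ℝ) : VIdx G → VIdx G → VIdx G → ℂ
  | Sum.inl (g, Sum.inl k), Sum.inl (h, x), r =>
      if x = Sum.inl (h + k) ∧ r = Sum.inl (g + h, Sum.inl (h + k)) then 1 else 0
  | Sum.inl (g, Sum.inr _), Sum.inl (h, x), r =>
      if x = Sum.inr () ∧ r = Sum.inl (g + h, Sum.inr ()) then 1 else 0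
  | Sum.inl (g, Sum.inl k), Sum.inr (Sum.inl k'), r =>
      if k = k' ∧ r = Sum.inr (Sum.inl (k' - g)) then 1 else 0
  | Sum.inl (_, Sum.inr _), Sum.inr (Sum.inl _), _ => 0
  | Sum.inl (_, Sum.inl _), Sum.inr (Sum.inr _), _ => 0
  | Sum.inl (g, Sum.inr _), Sum.inr (Sum.inr k'), r =>
      if r = Sum.inr (Sum.inr k') then χ g k' else 0
  | Sum.inr (Sum.inl k), Sum.inl (g, x), r =>
      if x = Sum.inr () ∧ r = Sum.inr (Sum.inl k) then χ g k else 0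
  | Sum.inr (Sum.inr k), Sum.inl (g, x), r =>
      if x = Sum.inl (g + k) ∧ r = Sum.inr (Sum.inr (g + k)) then 1 else 0
  | Sum.inr (Sum.inl h), Sum.inr (Sum.inr k), r =>
      if r = Sum.inl (k - h, Sum.inl k) then 1 else 0
  | Sum.inr (Sum.inr h), Sum.inr (Sum.inl k), r =>
      if h = k then
        (match r with
          | Sum.inl (g, Sum.inr _) => (τ : ℂ) * (χ g h)⁻¹
          | _ => 0)
      else 0
  | Sum.inr (Sum.inl _), Sum.inr (Sum.inl _), _ => 0
  | Sum.inr (Sum.inr _), Sum.inr (Sum.inr _), _ => 0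

/-- The multiplication of the Tambara–Yamagami WHA:
`f^x_{α,β} f^y_{γ,δ} = (v^x_α ∘ v^y_γ) ⊗ conj (v^x_β ∘ v^y_δ)`. -/
def mulTY (χ : G → G → ℂ) (τ : ℝ) (f f' : TYB G) : TYB G := fun r =>
  ∑ p : BIdx G, ∑ q : BIdx G,
    f p * f' q * circC G χ τ p.1.1 q.1.1 r.1.1 * star (circC G χ τ p.1.2 q.1.2 r.1.2)

/-- The unit `1 = Σ_{z,w ∈ Ω} f^0_{z,w}` of the Tambara–Yamagami WHA. -/
def oneTY : TYB G := fun r =>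
  match r.1.1 with
  | Sum.inl (g, _) => if g = 0 then 1 else 0
  | Sum.inr _ => 0

/-- Structure constants of the coproduct: `Δ(f^x_{α,β}) = Σ_γ f^x_{α,γ} ⊗ f^x_{γ,β}`. -/
def Δc : BIdx G → BIdx G → BIdx G → ℂ := fun p q r =>
  if q.1.1 = p.1.1 ∧ r.1.2 = p.1.2 ∧ q.1.2 = r.1.1 then 1 else 0

/-- The coproduct, with `B ⊗ B` realized as `BIdx × BIdx → ℂ`. -/
def ΔTY (f : TYB G) : BIdx G × BIdx G → ℂ := fun qr => ∑ p : BIdx G, f p * Δc G p qr.1 qr.2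

/-- The counit `ε(f^x_{α,β}) = δ_{α,β}`. -/
def εTY (f : TYB G) : ℂ := ∑ p : BIdx G, f p * (if p.1.1 = p.1.2 then 1 else 0)

/-- Translation of an index in `Ω` (`m` unaffected). -/
def shiftΩ : ΩIdx G → G → ΩIdx G
  | Sum.inl h, g => Sum.inl (h - g)
  | Sum.inr u, _ => Sum.inr u

/-- Structure constants of the involution `*`. -/
def starCoef (τ : ℝ) : BIdx G → BIdx G → ℂ := fun p r =>
  match p.1, r.1 with
  | (Sum.inl (g, a), Sum.inl (g', b)), (Sum.inl (g₂, a₂), Sum.inl (g₂', b₂)) =>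
      if g₂ = -g ∧ g₂' = -g' ∧ a₂ = shiftΩ G a g ∧ b₂ = shiftΩ G b g' then 1 else 0
  | (Sum.inr α, Sum.inr β), (Sum.inr α₂, Sum.inr β₂) =>
      if α₂ = α.swap ∧ β₂ = β.swap then
        (match α, β with
          | Sum.inl _, Sum.inr _ => (τ : ℂ)
          | Sum.inr _, Sum.inl _ => (τ : ℂ)⁻¹
          | _, _ => 1)
      else 0
  | _, _ => 0

/-- The (conjugate-linear) involution of the Tambara–Yamagami WHA. -/
def starTY (τ : ℝ) (f : TYB G) : TYB G := fun r =>
  ∑ p : BIdx G, (starRingEnd ℂ) (f p) * starCoef G τ p r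

/-- Structure constants of the antipode `S`. -/
def SCoef (τ : ℝ) : BIdx G → BIdx G → ℂ := fun p r =>
  match p.1, r.1 with
  | (Sum.inl (g, a), Sum.inl (_, b)), (Sum.inl (g₂, a₂), Sum.inl (g₂', b₂)) =>
      if g₂ = -g ∧ g₂' = -g ∧ a₂ = shiftΩ G b g ∧ b₂ = shiftΩ G a g then 1 else 0
  | (Sum.inr α, Sum.inr β), (Sum.inr α₂, Sum.inr β₂) =>
      if α₂ = β.swap ∧ β₂ = α.swap then
        (match α, β with
          | Sum.inl _, Sum.inr _ => (τ : ℂ)⁻¹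
          | Sum.inr _, Sum.inl _ => (τ : ℂ)
          | _, _ => 1)
      else 0
  | _, _ => 0

/-- The antipode of the Tambara–Yamagami WHA. -/
def STY (τ : ℝ) (f : TYB G) : TYB G := fun r => ∑ p : BIdx G, f p * SCoef G τ p r

/-- The right adjoint action `a ◁ x = S(x₍₁₎) a x₍₂₎`. -/
def adTY (χ : G → G → ℂ) (τ : ℝ) (a x : TYB G) : TYB G :=
  ∑ p : BIdx G, ∑ q₁ : BIdx G, ∑ q₂ : BIdx G,
    (x p * Δc G p q₁ q₂) •
      mulTY G χ τ (mulTY G χ τ (STY G τ (Pi.single q₁ 1)) a) (Pi.single q₂ 1)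

/-- `I` is a coideal of the Tambara–Yamagami WHA: a unital `*`-subalgebra with
`Δ(I) ⊆ I ⊗ B`. -/
def IsCoidealTY (χ : G → G → ℂ) (τ : ℝ) (I : Submodule ℂ (TYB G)) : Prop :=
  oneTY G ∈ I ∧ (∀ a ∈ I, ∀ b ∈ I, mulTY G χ τ a b ∈ I) ∧ (∀ a ∈ I, starTY G τ a ∈ I) ∧
    ∀ a ∈ I, ΔTY G a ∈ Submodule.span ℂ
      {t : BIdx G × BIdx G → ℂ | ∃ u ∈ I, ∃ v : TYB G, t = fun qr => u qr.1 * v qr.2}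

/-- `I` is invariant: `span{S(x₍₁₎) a x₍₂₎ : a ∈ I, x ∈ B} = I`. -/
def IsInvariantTY (χ : G → G → ℂ) (τ : ℝ) (I : Submodule ℂ (TYB G)) : Prop :=
  Submodule.span ℂ {y : TYB G | ∃ a ∈ I, ∃ x : TYB G, y = adTY G χ τ a x} = I

/-- The source counital map `ε_s(b) = (id ⊗ ε)((1 ⊗ b)Δ(1))`. -/
def εsTY (χ : G → G → ℂ) (τ : ℝ) (b : TYB G) : TYB G := fun s =>
  ∑ r : BIdx G, (ΔTY G (oneTY G) (s, r)) * εTY G (mulTY G χ τ b (Pi.single r 1))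

/-- `B_s = ε_s(B)`. -/
def BsTY (χ : G → G → ℂ) (τ : ℝ) : Submodule ℂ (TYB G) :=
  Submodule.span ℂ (Set.range (εsTY G χ τ))

/-- `L^⊥ = {g : χ(g,l) = 1 ∀ l ∈ L}`. -/
def Lperp (χ : G → G → ℂ) (L : AddSubgroup G) : Set G := {g : G | ∀ l ∈ L, χ g l = 1}

/-- The element `v^0_Y ⊗ conj (v^0_w)` of `B`, for `Y ⊆ G` and `w ∈ Ω`. -/
def bCoset (Y : Set G) (w : ΩIdx G) : TYB G := fun p =>
  match p.1 with
  | (Sum.inl (g, Sum.inl y), Sum.inl (g', w')) =>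
      if g = 0 ∧ g' = 0 ∧ w' = w ∧ y ∈ Y then 1 else 0
  | _ => 0

/-- The element `v^l_m ⊗ conj (v^l_w)` of `B`, for `l ∈ G` and `w ∈ Ω`. -/
def bM (l : G) (w : ΩIdx G) : TYB G := fun p =>
  match p.1 with
  | (Sum.inl (g, Sum.inr _), Sum.inl (g', w')) => if g = l ∧ g' = l ∧ w' = w then 1 else 0
  | _ => 0

/-- The coideal `I^L = span{v^0_Y : Y ∈ G/L} ⊗ conj(H^0) ⊕ Σ_{l ∈ L^⊥} ℂ v^l_m ⊗ conj(H^l)`. -/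
def ILTY (χ : G → G → ℂ) (L : AddSubgroup G) : Submodule ℂ (TYB G) :=
  Submodule.span ℂ
    ({b : TYB G | ∃ g : G, ∃ w : ΩIdx G, b = bCoset G {x : G | x - g ∈ L} w} ∪
      {b : TYB G | ∃ l ∈ Lperp G χ L, ∃ w : ΩIdx G, b = bM G l w})

end TY

section Columns

set_option linter.unusedSectionVars false

variable {G : Type} [AddCommGroup G] [Fintype G] [DecidableEq G]

/-- The bilinear product `∘` on `V`. -/
def circ (χ : G → G → ℂ) (τ : ℝ) : TYV G →ₗ[ℂ] TYV G →ₗ[ℂ] TYV G :=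
  LinearMap.mk₂ ℂ (fun u v r => ∑ a, ∑ b, u a * v b * circC G χ τ a b r)
    (by intro u u' v; funext r; simp [add_mul, Finset.sum_add_distrib])
    (by intro c u v; funext r; simp only [Pi.smul_apply, smul_eq_mul, Finset.mul_sum, mul_assoc])
    (by intro u v v'; funext r; simp [add_mul, mul_add, Finset.sum_add_distrib])
    (by
      intro c u v
      funext r
      simp only [Pi.smul_apply, smul_eq_mul, Finset.mul_sum]
      exact Finset.sum_congr rfl fun a _ => Finset.sum_congr rfl fun b _ => by ring)

lemma circ_apply (χ : G → G → ℂ) (τ : ℝ) (u v : TYV G) (r : VIdx G) :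
    circ χ τ u v r = ∑ a, ∑ b, u a * v b * circC G χ τ a b r := rfl

/-- The basis vector of `V` with index `a`. -/
def basisV (a : VIdx G) : TYV G := fun b => if b = a then 1 else 0

@[simp] lemma circ_basisV (χ : G → G → ℂ) (τ : ℝ) (a b : VIdx G) :
    circ χ τ (basisV a) (basisV b) = circC G χ τ a b := by
  funext r
  simp [circ_apply, basisV]

/-- The element `u ⊗ conj v_β` of `B`, where `u` is first projected to the grade of `β`. -/
def column (β : VIdx G) : TYV G →ₗ[ℂ] TYB G where
  toFun u := fun p => if p.1.2 = β then u p.1.1 else 0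
  map_add' u v := by funext p; by_cases h : p.1.2 = β <;> simp [h]
  map_smul' c u := by funext p; by_cases h : p.1.2 = β <;> simp [h]

lemma column_apply (β : VIdx G) (u : TYV G) (p : BIdx G) :
    column β u p = if p.1.2 = β then u p.1.1 else 0 := rfl

/-- `u` is homogeneous of grade `x`. -/
def Homog (u : TYV G) (x : ΩIdx G) : Prop := ∀ a, u a ≠ 0 → tyGrade G a = x

lemma homog_basisV (a : VIdx G) : Homog (basisV a) (tyGrade G a) := by
  intro b hb
  by_cases h : b = a
  · rw [h]
  · simp [basisV, h] at hb

lemma column_eq_zero {β : VIdx G} {u : TYV G} {x : ΩIdx G} (hu : Homog u x)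
    (h : tyGrade G β ≠ x) : column β u = 0 := by
  funext p
  rw [column_apply]
  split_ifs with hp
  · by_contra hne
    exact h (by rw [← hp, ← p.2, hu _ hne])
  · rfl

lemma sum_BIdx {M : Type*} [AddCommMonoid M] (F : VIdx G → VIdx G → M) :
    ∑ p : BIdx G, F p.1.1 p.1.2 =
      ∑ a, ∑ b, if tyGrade G a = tyGrade G b then F a b else 0 := by
  rw [← Fintype.sum_prod_type' (f := fun a b => if tyGrade G a = tyGrade G b then F a b else 0),
    ← Finset.sum_filter,
    Finset.sum_subtype (Finset.univ.filter
      fun p : VIdx G × VIdx G => tyGrade G p.1 = tyGrade G p.2)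
      (p := fun p => tyGrade G p.1 = tyGrade G p.2) (by simp)]

lemma single_eq_column (p : BIdx G) :
    (Pi.single p 1 : TYB G) = column p.1.2 (basisV p.1.1) := by
  funext q
  simp only [column_apply, basisV, Pi.single_apply, Subtype.ext_iff, Prod.ext_iff]
  by_cases h1 : q.1.1 = p.1.1 <;> by_cases h2 : q.1.2 = p.1.2 <;> simp [h1, h2]

/-- The multiplication of `B` as a bilinear map. -/
def mulLin (χ : G → G → ℂ) (τ : ℝ) : TYB G →ₗ[ℂ] TYB G →ₗ[ℂ] TYB G :=
  LinearMap.mk₂ ℂ (mulTY G χ τ)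
    (by intro u u' v; funext r; simp [mulTY, add_mul, Finset.sum_add_distrib])
    (by intro c u v; funext r; simp [mulTY, Finset.mul_sum, mul_assoc])
    (by intro u v v'; funext r; simp [mulTY, add_mul, mul_add, Finset.sum_add_distrib])
    (by intro c u v; funext r; simp [mulTY, Finset.mul_sum, mul_assoc, mul_left_comm])

lemma mulLin_apply (χ : G → G → ℂ) (τ : ℝ) (a b : TYB G) :
    mulLin χ τ a b = mulTY G χ τ a b := rfl

lemma mulLin_column (χ : G → G → ℂ) (τ : ℝ) {u v : TYV G} {β γ : VIdx G}
    (hu : Homog u (tyGrade G β)) (hv : Homog v (tyGrade G γ)) :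
    mulLin χ τ (column β u) (column γ v) =
      ∑ δ, star (circC G χ τ β γ δ) • column δ (circ χ τ u v) := by
  have key : ∀ (u : TYV G) (β : VIdx G), Homog u (tyGrade G β) →
      ∀ F : VIdx G → VIdx G → ℂ,
      ∑ p : BIdx G, column β u p * F p.1.1 p.1.2 = ∑ a, u a * F a β := by
    intro u β hu F
    simp only [column_apply]
    rw [sum_BIdx (fun a b => (if b = β then u a else 0) * F a b)]
    refine Finset.sum_congr rfl fun a _ => ?_
    rw [Finset.sum_eq_single β]
    · by_cases h : u a = 0
      · simp [h]
      · simp [hu a h]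
    · intro b _ hb
      simp [hb]
    · simp
  funext r
  rw [Finset.sum_apply]
  simp only [Pi.smul_apply, column_apply, smul_eq_mul, mul_ite, mul_zero,
    Finset.sum_ite_eq, Finset.mem_univ, if_true]
  rw [mulLin_apply, mulTY]
  have h2 : ∀ p : BIdx G, ∑ q : BIdx G, column β u p * column γ v q *
      circC G χ τ p.1.1 q.1.1 r.1.1 * star (circC G χ τ p.1.2 q.1.2 r.1.2) =
      column β u p * ∑ b, v b * (circC G χ τ p.1.1 b r.1.1 *
        star (circC G χ τ p.1.2 γ r.1.2)) := by
    intro p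
    rw [← key v γ hv (fun b c => circC G χ τ p.1.1 b r.1.1 * star (circC G χ τ p.1.2 c r.1.2)),
      Finset.mul_sum]
    exact Finset.sum_congr rfl fun q _ => by ring
  rw [Finset.sum_congr rfl fun p _ => h2 p,
    key u β hu (fun a c => ∑ b, v b * (circC G χ τ a b r.1.1 * star (circC G χ τ c γ r.1.2))),
    circ_apply, Finset.mul_sum]
  refine Finset.sum_congr rfl fun a _ => ?_
  rw [Finset.mul_sum, Finset.mul_sum]
  exact Finset.sum_congr rfl fun b _ => by ring

/-- The grade of a product `v ∘ w` with `w` of invertible grade `l`. -/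
def gradeAdd : ΩIdx G → G → ΩIdx G
  | Sum.inl g, l => Sum.inl (g + l)
  | Sum.inr u, _ => Sum.inr u

lemma tyGrade_of_circC_ne_zero (χ : G → G → ℂ) (τ : ℝ) {a b c : VIdx G} {l : G}
    (hb : tyGrade G b = Sum.inl l) (h : circC G χ τ a b c ≠ 0) :
    tyGrade G c = gradeAdd (tyGrade G a) l := by
  rcases b with ⟨l', b⟩ | b
  · obtain rfl : l' = l := by simpa [tyGrade] using hb
    rcases a with ⟨g, k | _⟩ | k | k <;> simp only [circC, ne_eq, ite_eq_right_iff] at h <;>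
      (push Not at h; rw [h.1.2]; rfl)
  · simp [tyGrade] at hb

lemma homog_circ (χ : G → G → ℂ) (τ : ℝ) {u v : TYV G} {x : ΩIdx G} {l : G}
    (hu : Homog u x) (hv : Homog v (Sum.inl l)) : Homog (circ χ τ u v) (gradeAdd x l) := by
  intro c hc
  rw [circ_apply] at hc
  obtain ⟨a, -, ha⟩ := Finset.exists_ne_zero_of_sum_ne_zero hc
  obtain ⟨b, -, hb⟩ := Finset.exists_ne_zero_of_sum_ne_zero ha
  have h1 : u a ≠ 0 := fun h => hb (by simp [h])
  have h2 : v b ≠ 0 := fun h => hb (by simp [h])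
  have h3 : circC G χ τ a b c ≠ 0 := fun h => hb (by simp [h])
  rw [tyGrade_of_circC_ne_zero χ τ (hv b h2) h3, hu a h1]

/-- The index of the conjugate basis vector. -/
def dualIdx : VIdx G → VIdx G
  | Sum.inl (g, a) => Sum.inl (-g, shiftΩ G a g)
  | Sum.inr a => Sum.inr a.swap

/-- The weight of a basis vector in the antipode. -/
def weight (τ : ℝ) : VIdx G → ℂ
  | Sum.inr (Sum.inr _) => (τ : ℂ)⁻¹
  | _ => 1

lemma tyGrade_dualIdx {a b : VIdx G} (h : tyGrade G a = tyGrade G b) :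
    tyGrade G (dualIdx a) = tyGrade G (dualIdx b) := by
  rcases a with ⟨g, a⟩ | a <;> rcases b with ⟨g', b⟩ | b <;> simp_all [tyGrade, dualIdx]

lemma STY_single {τ : ℝ} (hτ : τ ≠ 0) (q : BIdx G) :
    STY G τ (Pi.single q 1) =
      ((weight τ q.1.1)⁻¹ * weight τ q.1.2) • column (dualIdx q.1.1) (basisV (dualIdx q.1.2)) := by
  funext r
  have : STY G τ (Pi.single q 1) r = SCoef G τ q r := by
    rw [STY, Finset.sum_eq_single q]
    · simp
    · intro b _ hb
      simp [hb]
    · simp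
  rw [this, Pi.smul_apply, column_apply, basisV]
  obtain ⟨⟨q1, q2⟩, hq⟩ := q
  obtain ⟨⟨r1, r2⟩, hr⟩ := r
  rcases q1 with ⟨g, a⟩ | a <;> rcases q2 with ⟨g', b⟩ | b <;>
    rcases r1 with ⟨k, c⟩ | c <;> rcases r2 with ⟨k', d⟩ | d <;>
    simp only [tyGrade, Sum.inl.injEq, reduceCtorEq] at hq hr
  · subst hq hr
    by_cases h1 : c = shiftΩ G b g <;> by_cases h2 : d = shiftΩ G a g <;>
      by_cases h3 : k = -g <;> simp [SCoef, dualIdx, weight, h1, h2, h3]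
  · simp [SCoef, dualIdx]
  · simp [SCoef, dualIdx]
  · by_cases h1 : c = b.swap <;> by_cases h2 : d = a.swap <;>
      rcases a with a | a <;> rcases b with b | b <;>
      simp_all [SCoef, dualIdx, weight]

/-- The twisted conjugation `u ↦ Σ_γ s(γ) (γ' ∘ u) ∘ γ` over the basis vectors of grade `x`. -/
def adV (χ : G → G → ℂ) (τ : ℝ) (x : ΩIdx G) : TYV G →ₗ[ℂ] TYV G :=
  ∑ γ : VIdx G, if tyGrade G γ = x then
    weight τ γ • ((circ χ τ).flip (basisV γ) ∘ₗ circ χ τ (basisV (dualIdx γ))) else 0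

lemma adV_apply (χ : G → G → ℂ) (τ : ℝ) (x : ΩIdx G) (u : TYV G) :
    adV χ τ x u = ∑ γ : VIdx G, if tyGrade G γ = x then
      weight τ γ • circ χ τ (circ χ τ (basisV (dualIdx γ)) u) (basisV γ) else 0 := by
  rw [adV, LinearMap.sum_apply]
  refine Finset.sum_congr rfl fun γ _ => ?_
  split_ifs <;> simp

lemma mulLin_conj_column (χ : G → G → ℂ) (τ : ℝ) {u : TYV G} {α α' β γ : VIdx G} {l : G}
    (hu : Homog u (Sum.inl l)) (hβ : tyGrade G β = Sum.inl l)
    (h : tyGrade G γ = tyGrade G α) (h' : tyGrade G γ = tyGrade G α') :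
    mulLin χ τ (mulLin χ τ (column (dualIdx α) (basisV (dualIdx γ))) (column β u))
        (column α' (basisV γ)) =
      ∑ δ, ∑ δ', (star (circC G χ τ (dualIdx α) β δ) * star (circC G χ τ δ α' δ')) •
        column δ' (circ χ τ (circ χ τ (basisV (dualIdx γ)) u) (basisV γ)) := by
  have hγ : Homog (basisV (dualIdx γ)) (tyGrade G (dualIdx α)) :=
    tyGrade_dualIdx h ▸ homog_basisV (dualIdx γ)
  rw [mulLin_column χ τ hγ (hβ ▸ hu), map_sum, LinearMap.sum_apply]
  refine Finset.sum_congr rfl fun δ _ => ?_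
  rw [map_smul, LinearMap.smul_apply]
  by_cases hδ : circC G χ τ (dualIdx α) β δ = 0
  · simp [hδ]
  · rw [mulLin_column χ τ _ (h' ▸ homog_basisV γ), Finset.smul_sum]
    · simp only [smul_smul]
    · rw [tyGrade_of_circC_ne_zero χ τ hβ hδ]
      exact homog_circ χ τ hγ hu

lemma adTY_eq_sum (χ : G → G → ℂ) (τ : ℝ) (a x : TYB G) :
    adTY G χ τ a x = ∑ p : BIdx G, x p • adTY G χ τ a (Pi.single p 1) := by
  have h : ∀ p : BIdx G, adTY G χ τ a (Pi.single p 1) = ∑ q₁ : BIdx G, ∑ q₂ : BIdx G,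
      Δc G p q₁ q₂ • mulTY G χ τ (mulTY G χ τ (STY G τ (Pi.single q₁ 1)) a) (Pi.single q₂ 1) := by
    intro p
    rw [adTY, Finset.sum_eq_single p]
    · simp
    · intro b _ hb
      simp [hb]
    · simp
  simp only [h, Finset.smul_sum, smul_smul]
  rfl

lemma adTY_add_left (χ : G → G → ℂ) (τ : ℝ) (a b x : TYB G) :
    adTY G χ τ (a + b) x = adTY G χ τ a x + adTY G χ τ b x := by
  simp only [adTY, ← mulLin_apply, map_add, LinearMap.add_apply, smul_add, Finset.sum_add_distrib]

lemma adTY_smul_left (χ : G → G → ℂ) (τ : ℝ) (c : ℂ) (a x : TYB G) :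
    adTY G χ τ (c • a) x = c • adTY G χ τ a x := by
  simp only [adTY, ← mulLin_apply, map_smul, LinearMap.smul_apply, Finset.smul_sum]
  refine Finset.sum_congr rfl fun p _ => Finset.sum_congr rfl fun q _ =>
    Finset.sum_congr rfl fun r _ => smul_comm _ _ _

lemma adTY_zero_left (χ : G → G → ℂ) (τ : ℝ) (x : TYB G) : adTY G χ τ 0 x = 0 := by
  simpa using adTY_smul_left χ τ 0 0 x

lemma sum_Δc {M : Type*} [AddCommGroup M] [Module ℂ M] (p : BIdx G)
    (F : VIdx G → VIdx G → VIdx G → VIdx G → M) :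
    ∑ q₁ : BIdx G, ∑ q₂ : BIdx G, Δc G p q₁ q₂ • F q₁.1.1 q₁.1.2 q₂.1.1 q₂.1.2 =
      ∑ γ, if tyGrade G γ = tyGrade G p.1.1 then F p.1.1 γ γ p.1.2 else 0 := by
  have h : ∀ q₁ : BIdx G, ∑ q₂ : BIdx G, Δc G p q₁ q₂ • F q₁.1.1 q₁.1.2 q₂.1.1 q₂.1.2 =
      if q₁.1.1 = p.1.1 then F p.1.1 q₁.1.2 q₁.1.2 p.1.2 else 0 := by
    intro q
    by_cases hq : q.1.1 = p.1.1
    · rw [if_pos hq, Finset.sum_eq_single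
        (⟨(q.1.2, p.1.2), by rw [← q.2, hq, p.2]⟩ : BIdx G)]
      · simp [Δc, hq]
      · intro r _ hr
        have : ¬ (r.1.2 = p.1.2 ∧ q.1.2 = r.1.1) := by
          rintro ⟨h1, h2⟩
          exact hr (Subtype.ext (Prod.ext h2.symm h1))
        simp [Δc, this]
      · simp
    · simp [Δc, hq]
  rw [Finset.sum_congr rfl fun q _ => h q,
    sum_BIdx (fun a b => if a = p.1.1 then F p.1.1 b b p.1.2 else 0), Finset.sum_comm]
  refine Finset.sum_congr rfl fun γ _ => ?_
  rw [Finset.sum_eq_single p.1.1]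
  · simp [eq_comm]
  · intro b _ hb
    simp [hb]
  · simp

lemma adTY_column_single (χ : G → G → ℂ) {τ : ℝ} (hτ : τ ≠ 0) {u : TYV G} {β : VIdx G} {l : G}
    (hu : Homog u (Sum.inl l)) (hβ : tyGrade G β = Sum.inl l) (p : BIdx G) :
    adTY G χ τ (column β u) (Pi.single p 1) =
      (weight τ p.1.1)⁻¹ • ∑ δ, ∑ δ',
        (star (circC G χ τ (dualIdx p.1.1) β δ) * star (circC G χ τ δ p.1.2 δ')) •
          column δ' (adV χ τ (tyGrade G p.1.1) u) := by
  have h : adTY G χ τ (column β u) (Pi.single p 1) = ∑ q₁ : BIdx G, ∑ q₂ : BIdx G,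
      Δc G p q₁ q₂ • mulLin χ τ (mulLin χ τ (((weight τ q₁.1.1)⁻¹ * weight τ q₁.1.2) •
        column (dualIdx q₁.1.1) (basisV (dualIdx q₁.1.2))) (column β u))
        (column q₂.1.2 (basisV q₂.1.1)) := by
    rw [adTY, Finset.sum_eq_single p]
    · simp only [STY_single hτ, ← single_eq_column, mulLin_apply, Pi.single_eq_same, one_mul]
    · intro b _ hb
      simp [hb]
    · simp
  rw [h, sum_Δc p (fun a b c d => mulLin χ τ (mulLin χ τ (((weight τ a)⁻¹ * weight τ b) •
    column (dualIdx a) (basisV (dualIdx b))) (column β u)) (column d (basisV c)))]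
  let K : TYV G →ₗ[ℂ] TYB G := ∑ δ, ∑ δ',
    (star (circC G χ τ (dualIdx p.1.1) β δ) * star (circC G χ τ δ p.1.2 δ')) • column δ'
  have hK : ∀ v, K v = ∑ δ, ∑ δ',
      (star (circC G χ τ (dualIdx p.1.1) β δ) * star (circC G χ τ δ p.1.2 δ')) • column δ' v := by
    intro v
    simp only [K, LinearMap.sum_apply, LinearMap.smul_apply]
  rw [← hK, adV_apply, map_sum, Finset.smul_sum]
  refine Finset.sum_congr rfl fun γ _ => ?_
  split_ifs with hγ
  · rw [map_smul, LinearMap.smul_apply, map_smul, LinearMap.smul_apply,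
      mulLin_conj_column χ τ hu hβ hγ (hγ.trans p.2), ← hK, map_smul, smul_smul]
  · simp

/-- The involution induced on `⊕_g H^g`. -/
def starV (u : TYV G) : TYV G
  | Sum.inl (g, a) => (starRingEnd ℂ) (u (Sum.inl (-g, shiftΩ G a g)))
  | Sum.inr _ => 0

/-- The unit of `V`. -/
def unitV : TYV G
  | Sum.inl (g, _) => if g = 0 then 1 else 0
  | Sum.inr _ => 0

/-- The span of the elements `u ⊗ conj v` with `u ∈ S`. -/
def columnSpan (S : Set (TYV G)) : Submodule ℂ (TYB G) :=
  Submodule.span ℂ {b | ∃ u ∈ S, ∃ β, b = column β u}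

lemma column_mem_columnSpan {S : Set (TYV G)} {u : TYV G} (hu : u ∈ Submodule.span ℂ S)
    (β : VIdx G) : column β u ∈ columnSpan S := by
  have h : Submodule.span ℂ S ≤ (columnSpan S).comap (column β) :=
    Submodule.span_le.2 fun v hv => Submodule.subset_span ⟨v, hv, β, rfl⟩
  exact h hu

lemma column_induction {l : G} {u : TYV G}
    (hu : Homog u (Sum.inl l)) {p : TYB G → Prop} (h0 : p 0)
    (h : ∀ w, p (column (Sum.inl (l, w)) u)) (β : VIdx G) : p (column β u) := by
  by_cases hβ : tyGrade G β = Sum.inl l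
  · rcases β with ⟨g, w⟩ | b
    · obtain rfl : g = l := by simpa [tyGrade] using hβ
      exact h w
    · simp [tyGrade] at hβ
  · rw [column_eq_zero hu hβ]
    exact h0

lemma oneTY_eq : oneTY G = ∑ w, column (Sum.inl (0, w)) (unitV : TYV G) := by
  funext r
  have h : oneTY G r = unitV r.1.1 := by
    rcases r with ⟨⟨⟨g, a⟩ | a, b⟩, hr⟩ <;> rfl
  rw [h, Finset.sum_apply]
  simp only [column_apply]
  obtain ⟨⟨a, b⟩, hr⟩ := r
  rcases a with ⟨g, a⟩ | a
  · rcases b with ⟨g', b⟩ | b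
    · obtain rfl : g = g' := by simpa [tyGrade] using hr
      by_cases hg : g = 0
      · subst hg
        simp only [Sum.inl.injEq, Prod.mk.injEq, true_and, Finset.sum_ite_eq, Finset.mem_univ,
          if_true]
      · simp [unitV, hg]
    · simp [tyGrade] at hr
  · simp [unitV]

lemma starTY_column (τ : ℝ) {u : TYV G} {l : G} (hu : Homog u (Sum.inl l)) (w : ΩIdx G) :
    starTY G τ (column (Sum.inl (l, w)) u) =
      column (Sum.inl (-l, shiftΩ G w l)) (starV u) := by
  have hs : ∀ (a : ΩIdx G) (g : G), shiftΩ G (shiftΩ G a g) (-g) = a := by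
    rintro (a | a) g <;> simp [shiftΩ]
  funext r
  rw [column_apply, starTY]
  have h : ∀ p : BIdx G, (starRingEnd ℂ) (column (Sum.inl (l, w)) u p) * starCoef G τ p r =
      if p.1.2 = Sum.inl (l, w) then (starRingEnd ℂ) (u p.1.1) * starCoef G τ p r else 0 := by
    intro p
    rw [column_apply]
    split_ifs <;> simp
  rw [Finset.sum_congr rfl fun p _ => h p]
  obtain ⟨⟨r1, r2⟩, hr⟩ := r
  rcases r1 with ⟨k, c⟩ | c <;> rcases r2 with ⟨k', d⟩ | d <;>
    simp only [tyGrade, Sum.inl.injEq, reduceCtorEq] at hr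
  · subst hr
    by_cases hk : k = -l
    · subst hk
      rw [Finset.sum_eq_single
        (⟨(Sum.inl (l, shiftΩ G c (-l)), Sum.inl (l, w)), rfl⟩ : BIdx G)]
      · have := hs c (-l)
        rw [neg_neg] at this
        simp [starCoef, starV, this]
      · rintro ⟨⟨a, b⟩, hab⟩ _ hne
        split_ifs with hb
        · simp only at hb
          subst hb
          rcases a with ⟨g, a⟩ | a
          · obtain rfl : g = l := by simpa [tyGrade] using hab
            have : c ≠ shiftΩ G a g := by
              rintro rfl
              exact hne (by simp [hs])
            simp [starCoef, this]
          · simp [tyGrade] at hab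
        · rfl
      · simp
    · rw [if_neg (by simp [hk])]
      refine Finset.sum_eq_zero ?_
      rintro ⟨⟨a, b⟩, hab⟩ _
      split_ifs with hb
      · simp only at hb
        subst hb
        rcases a with ⟨g, a⟩ | a
        · obtain rfl : g = l := by simpa [tyGrade] using hab
          simp [starCoef, hk]
        · simp [tyGrade] at hab
      · rfl
  · rw [if_neg (by simp)]
    refine Finset.sum_eq_zero ?_
    rintro ⟨⟨a, b⟩, hab⟩ _
    split_ifs with hb
    · simp only at hb
      subst hb
      rcases a with ⟨g, a⟩ | a
      · simp [starCoef]
      · simp [tyGrade] at hab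
    · rfl

lemma ΔTY_column (β : VIdx G) (u : TYV G) :
    ΔTY G (column β u) =
      ∑ γ, fun qr : BIdx G × BIdx G => column γ u qr.1 * column β (basisV γ) qr.2 := by
  funext ⟨q, r⟩
  rw [Finset.sum_apply, ΔTY]
  simp only [column_apply, basisV]
  by_cases hr : r.1.2 = β
  · by_cases hqr : q.1.2 = r.1.1
    · rw [Finset.sum_eq_single (⟨(q.1.1, β), by rw [q.2, hqr, r.2, hr]⟩ : BIdx G),
        Finset.sum_eq_single q.1.2]
      · simp [Δc, hqr, hr]
      · intro b _ hb
        simp [hb.symm]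
      · simp
      · intro b _ hb
        by_cases h1 : q.1.1 = b.1.1 <;> by_cases h2 : b.1.2 = β
        · exact (hb (Subtype.ext (Prod.ext h1.symm h2))).elim
        all_goals simp [Δc, h1, h2]
      · simp
    · rw [Finset.sum_eq_zero, Finset.sum_eq_zero]
      · intro b _
        by_cases h1 : q.1.2 = b
        · subst h1
          simp [Ne.symm hqr]
        · simp [h1]
      · intro b _
        simp [Δc, hqr]
  · rw [Finset.sum_eq_zero, Finset.sum_eq_zero]
    · intro b _
      simp [hr]
    · intro b _
      by_cases h : b.1.2 = β
      · simp [Δc, h, hr]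
      · simp [h]

theorem isCoidealTY_columnSpan (χ : G → G → ℂ) (τ : ℝ) {S : Set (TYV G)}
    (hS : ∀ u ∈ S, ∃ l, Homog u (Sum.inl l)) (hone : unitV ∈ Submodule.span ℂ S)
    (hmul : ∀ u ∈ S, ∀ v ∈ S, circ χ τ u v ∈ Submodule.span ℂ S)
    (hstar : ∀ u ∈ S, starV u ∈ Submodule.span ℂ S) :
    IsCoidealTY G χ τ (columnSpan S) := by
  refine ⟨?_, ?_, ?_, ?_⟩
  · rw [oneTY_eq]
    exact Submodule.sum_mem _ fun w _ => column_mem_columnSpan hone _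
  · have h : Submodule.map₂ (mulLin χ τ) (columnSpan S) (columnSpan S) ≤ columnSpan S := by
      rw [columnSpan, Submodule.map₂_span_span, Submodule.span_le]
      rintro _ ⟨_, ⟨u, hu, β, rfl⟩, _, ⟨v, hv, γ, rfl⟩, rfl⟩
      obtain ⟨l, hl⟩ := hS u hu
      obtain ⟨k, hk⟩ := hS v hv
      change mulLin χ τ (column β u) (column γ v) ∈ columnSpan S
      by_cases h1 : tyGrade G β = Sum.inl l
      · by_cases h2 : tyGrade G γ = Sum.inl k
        · rw [mulLin_column χ τ (h1 ▸ hl) (h2 ▸ hk)]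
          exact Submodule.sum_mem _ fun δ _ =>
            Submodule.smul_mem _ _ (column_mem_columnSpan (hmul u hu v hv) _)
        · simp [column_eq_zero hk h2]
      · simp [column_eq_zero hl h1]
    intro a ha b hb
    exact h (Submodule.apply_mem_map₂ _ ha hb)
  · intro a ha
    induction ha using Submodule.span_induction with
    | mem a ha =>
      obtain ⟨u, hu, β, rfl⟩ := ha
      obtain ⟨l, hl⟩ := hS u hu
      refine column_induction hl (p := fun b => starTY G τ b ∈ columnSpan S) ?_ ?_ β
      · rw [show starTY G τ 0 = 0 by funext r; simp [starTY]]
        exact Submodule.zero_mem _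
      · intro w
        rw [starTY_column τ hl]
        exact column_mem_columnSpan (hstar u hu) _
    | zero =>
      rw [show starTY G τ 0 = 0 by funext r; simp [starTY]]
      exact Submodule.zero_mem _
    | add a b _ _ ha hb =>
      rw [show starTY G τ (a + b) = starTY G τ a + starTY G τ b by
        funext r; simp [starTY, add_mul, Finset.sum_add_distrib]]
      exact Submodule.add_mem _ ha hb
    | smul c a _ ha =>
      rw [show starTY G τ (c • a) = (starRingEnd ℂ) c • starTY G τ a by
        funext r; simp [starTY, Finset.mul_sum, mul_assoc]]
      exact Submodule.smul_mem _ _ ha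
  · intro a ha
    induction ha using Submodule.span_induction with
    | mem a ha =>
      obtain ⟨u, hu, β, rfl⟩ := ha
      rw [ΔTY_column]
      exact Submodule.sum_mem _ fun γ _ => Submodule.subset_span
        ⟨column γ u, column_mem_columnSpan (Submodule.subset_span hu) γ, column β (basisV γ), rfl⟩
    | zero =>
      rw [show ΔTY G 0 = 0 by funext r; simp [ΔTY]]
      exact Submodule.zero_mem _
    | add a b _ _ ha hb =>
      rw [show ΔTY G (a + b) = ΔTY G a + ΔTY G b by
        funext r; simp [ΔTY, add_mul, Finset.sum_add_distrib]]
      exact Submodule.add_mem _ ha hb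
    | smul c a _ ha =>
      rw [show ΔTY G (c • a) = c • ΔTY G a by
        funext r; simp [ΔTY, Finset.mul_sum, mul_assoc]]
      exact Submodule.smul_mem _ _ ha

lemma adTY_column_unit (χ : G → G → ℂ) {τ : ℝ} (hτ : τ ≠ 0) {u : TYV G} {l : G}
    (hu : Homog u (Sum.inl l)) (hid : adV χ τ (Sum.inl 0) u = u) (w : ΩIdx G) :
    adTY G χ τ (column (Sum.inl (l, w)) u) (Pi.single
      ⟨(Sum.inl (0, shiftΩ G w l), Sum.inl (0, w)), rfl⟩ 1) = column (Sum.inl (l, w)) u := by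
  have h1 : ∀ δ, circC G χ τ (dualIdx (Sum.inl (0, shiftΩ G w l))) (Sum.inl (l, w)) δ =
      if δ = Sum.inl (l, w) then 1 else 0 := by
    intro δ
    rcases w with w | w <;> simp [dualIdx, shiftΩ, circC]
  have h2 : ∀ δ, circC G χ τ (Sum.inl (l, w)) (Sum.inl (0, w)) δ =
      if δ = Sum.inl (l, w) then 1 else 0 := by
    intro δ
    rcases w with w | w <;> simp [circC]
  rw [adTY_column_single χ hτ hu rfl, Finset.sum_eq_single (Sum.inl (l, w)),
    Finset.sum_eq_single (Sum.inl (l, w))]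
  · simp [h1, h2, weight, tyGrade, hid]
  · intro b _ hb
    simp [h2, hb]
  · simp
  · intro b _ hb
    simp [h1, hb]
  · simp

theorem isInvariantTY_columnSpan (χ : G → G → ℂ) {τ : ℝ} (hτ : τ ≠ 0) {S : Set (TYV G)}
    (hS : ∀ u ∈ S, ∃ l, Homog u (Sum.inl l))
    (had : ∀ u ∈ S, ∀ x, adV χ τ x u ∈ Submodule.span ℂ S)
    (hid : ∀ u ∈ S, adV χ τ (Sum.inl 0) u = u) :
    IsInvariantTY G χ τ (columnSpan S) := by
  refine le_antisymm (Submodule.span_le.2 ?_) (Submodule.span_le.2 ?_)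
  · rintro _ ⟨a, ha, x, rfl⟩
    rw [adTY_eq_sum]
    refine Submodule.sum_mem _ fun p _ => Submodule.smul_mem _ _ ?_
    induction ha using Submodule.span_induction with
    | mem a ha =>
      obtain ⟨u, hu, β, rfl⟩ := ha
      obtain ⟨l, hl⟩ := hS u hu
      by_cases hβ : tyGrade G β = Sum.inl l
      · rw [adTY_column_single χ hτ hl hβ]
        exact Submodule.smul_mem _ _ <| Submodule.sum_mem _ fun δ _ =>
          Submodule.sum_mem _ fun δ' _ => Submodule.smul_mem _ _ <|
            column_mem_columnSpan (had u hu _) _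
      · rw [column_eq_zero hl hβ, adTY_zero_left]
        exact Submodule.zero_mem _
    | zero =>
      rw [adTY_zero_left]
      exact Submodule.zero_mem _
    | add a b _ _ ha hb =>
      rw [adTY_add_left]
      exact Submodule.add_mem _ ha hb
    | smul c a _ ha =>
      rw [adTY_smul_left]
      exact Submodule.smul_mem _ _ ha
  · rintro _ ⟨u, hu, β, rfl⟩
    obtain ⟨l, hl⟩ := hS u hu
    refine column_induction hl (p := fun b => b ∈ Submodule.span ℂ
      {y : TYB G | ∃ a ∈ columnSpan S, ∃ x : TYB G, y = adTY G χ τ a x})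
      (Submodule.zero_mem _) (fun w => ?_) β
    exact Submodule.subset_span ⟨_, column_mem_columnSpan (Submodule.subset_span hu) _, _,
      (adTY_column_unit χ hτ hl (hid u hu) w).symm⟩

lemma adV_inl (χ : G → G → ℂ) (τ : ℝ) (g : G) (u : TYV G) :
    adV χ τ (Sum.inl g) u = ∑ a, circ χ τ
      (circ χ τ (basisV (Sum.inl (-g, shiftΩ G a g))) u) (basisV (Sum.inl (g, a))) := by
  rw [adV_apply, Fintype.sum_sum_type, Fintype.sum_prod_type, Finset.sum_eq_single g]
  · simp [-Fintype.sum_sum_type, tyGrade, weight, dualIdx]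
  · intro b _ hb
    simp [tyGrade, hb]
  · simp

lemma adV_inr (χ : G → G → ℂ) (τ : ℝ) (u : TYV G) :
    adV χ τ (Sum.inr ()) u =
      ∑ h, circ χ τ (circ χ τ (basisV (Sum.inr (Sum.inr h))) u) (basisV (Sum.inr (Sum.inl h))) +
      (τ : ℂ)⁻¹ • ∑ h, circ χ τ (circ χ τ (basisV (Sum.inr (Sum.inl h))) u)
        (basisV (Sum.inr (Sum.inr h))) := by
  rw [adV_apply]
  simp [tyGrade, weight, dualIdx, Finset.smul_sum]

/-- The basis vector `v^0_k`. -/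
def pointV (k : G) : TYV G := basisV (Sum.inl (0, Sum.inl k))

/-- The basis vector `v^l_m`. -/
def invV (l : G) : TYV G := basisV (Sum.inl (l, Sum.inr ()))

/-- The vector `Σ_k φ(k) v^0_k`. -/
def funV : (G → ℂ) →ₗ[ℂ] TYV G := Fintype.linearCombination ℂ pointV

lemma funV_eq (φ : G → ℂ) : funV φ = ∑ k, φ k • pointV k :=
  Fintype.linearCombination_apply ..

lemma funV_apply (φ : G → ℂ) (a : VIdx G) :
    funV φ a = match a with
      | Sum.inl (g, Sum.inl k) => if g = 0 then φ k else 0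
      | _ => 0 := by
  rw [funV_eq, Finset.sum_apply]
  rcases a with ⟨g, k | k⟩ | a
  · by_cases hg : g = 0 <;> simp [pointV, basisV, hg]
  · simp [pointV, basisV]
  · simp [pointV, basisV]

lemma homog_funV (φ : G → ℂ) : Homog (funV φ) (Sum.inl 0) := by
  intro a ha
  rw [funV_apply] at ha
  rcases a with ⟨g, k | k⟩ | a <;> simp_all [tyGrade]

lemma homog_invV (l : G) : Homog (invV l) (Sum.inl l) := homog_basisV _

lemma unitV_eq : (unitV : TYV G) = funV 1 + invV 0 := by
  funext a
  rw [Pi.add_apply, funV_apply]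
  rcases a with ⟨g, k | k⟩ | a <;> simp [unitV, invV, basisV]

lemma starV_funV (φ : G → ℂ) : starV (funV φ) = funV fun k => (starRingEnd ℂ) (φ k) := by
  funext a
  rw [funV_apply]
  rcases a with ⟨g, k | k⟩ | a <;> simp only [starV, funV_apply, shiftΩ]
  · by_cases hg : g = 0 <;> simp [hg]
  · simp

lemma starV_invV (l : G) : starV (invV l) = invV (-l) := by
  funext a
  rcases a with ⟨g, k | k⟩ | a <;> simp [starV, invV, basisV, shiftΩ, neg_eq_iff_eq_neg, apply_ite]

lemma starV_add (u v : TYV G) : starV (u + v) = starV u + starV v := by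
  funext a
  rcases a with ⟨g, k⟩ | a <;> simp [starV]

lemma circ_pointV (χ : G → G → ℂ) (τ : ℝ) (k k' : G) :
    circ χ τ (pointV k) (pointV k') = if k = k' then pointV k else 0 := by
  rw [pointV, pointV, circ_basisV]
  funext r
  by_cases h : k = k' <;> simp [circC, h, basisV, eq_comm]

lemma circ_pointV_invV (χ : G → G → ℂ) (τ : ℝ) (k l : G) :
    circ χ τ (pointV k) (invV l) = 0 := by
  rw [pointV, invV, circ_basisV]
  funext r
  simp [circC]

lemma circ_invV_pointV (χ : G → G → ℂ) (τ : ℝ) (k l : G) :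
    circ χ τ (invV l) (pointV k) = 0 := by
  rw [pointV, invV, circ_basisV]
  funext r
  simp [circC]

lemma circ_invV (χ : G → G → ℂ) (τ : ℝ) (l l' : G) :
    circ χ τ (invV l) (invV l') = invV (l + l') := by
  rw [invV, invV, circ_basisV]
  funext r
  simp [circC, invV, basisV]

lemma circ_funV (χ : G → G → ℂ) (τ : ℝ) (φ ψ : G → ℂ) :
    circ χ τ (funV φ) (funV ψ) = funV (φ * ψ) := by
  simp [funV_eq, map_sum, LinearMap.sum_apply, circ_pointV, smul_smul, mul_comm]

lemma circ_funV_invV (χ : G → G → ℂ) (τ : ℝ) (φ : G → ℂ) (l : G) :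
    circ χ τ (funV φ) (invV l) = 0 := by
  simp [funV_eq, map_sum, LinearMap.sum_apply, circ_pointV_invV]

lemma circ_invV_funV (χ : G → G → ℂ) (τ : ℝ) (φ : G → ℂ) (l : G) :
    circ χ τ (invV l) (funV φ) = 0 := by
  simp [funV_eq, map_sum, circ_invV_pointV]

lemma adV_inl_pointV (χ : G → G → ℂ) (τ : ℝ) (g k : G) :
    adV χ τ (Sum.inl g) (pointV k) = pointV (k + g) := by
  have h1 : ∀ a, circ χ τ (basisV (Sum.inl (-g, shiftΩ G a g))) (pointV k) =
      if a = Sum.inl (k + g) then basisV (Sum.inl (-g, Sum.inl k)) else 0 := by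
    intro a
    rw [pointV, circ_basisV]
    funext r
    rcases a with a | a
    · by_cases h : a = k + g
      · subst h
        simp [circC, shiftΩ, basisV]
      · have : k ≠ a - g := fun h' => h (by rw [h']; abel)
        simp [circC, shiftΩ, h, this]
    · simp [circC, shiftΩ]
  rw [adV_inl, Finset.sum_eq_single (Sum.inl (k + g))]
  · rw [h1, if_pos rfl, circ_basisV]
    funext r
    simp [circC, pointV, basisV, add_comm g k]
  · intro b _ hb
    simp [h1, hb]
  · simp

lemma adV_inl_invV (χ : G → G → ℂ) (τ : ℝ) (g l : G) :
    adV χ τ (Sum.inl g) (invV l) = invV l := by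
  have h1 : ∀ a, circ χ τ (basisV (Sum.inl (-g, shiftΩ G a g))) (invV l) =
      if a = Sum.inr () then invV (-g + l) else 0 := by
    intro a
    rw [invV, circ_basisV]
    funext r
    rcases a with a | a <;> simp [circC, shiftΩ, invV, basisV]
  rw [adV_inl, Finset.sum_eq_single (Sum.inr ())]
  · rw [h1, if_pos rfl, ← invV, circ_invV]
    congr 1
    abel
  · intro b _ hb
    simp [h1, hb]
  · simp

lemma adV_inr_pointV (χ : G → G → ℂ) (τ : ℝ) (k : G) :
    adV χ τ (Sum.inr ()) (pointV k) = (τ : ℂ) • ∑ g, (χ g k)⁻¹ • invV g := by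
  have h1 : ∀ h, circ χ τ (basisV (Sum.inr (Sum.inr h))) (pointV k) =
      if k = h then basisV (Sum.inr (Sum.inr h)) else 0 := by
    intro h
    rw [pointV, circ_basisV]
    funext r
    by_cases hk : k = h <;> simp [circC, basisV, hk]
  have h2 : ∀ h, circ χ τ (basisV (Sum.inr (Sum.inl h))) (pointV k) = 0 := by
    intro h
    rw [pointV, circ_basisV]
    funext r
    simp [circC]
  rw [adV_inr, Finset.sum_eq_single k]
  · simp only [h1, h2, if_true, map_zero, LinearMap.zero_apply, Finset.sum_const_zero, smul_zero,
      add_zero, circ_basisV]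
    funext r
    rw [Pi.smul_apply, Finset.sum_apply]
    rcases r with ⟨g, a | a⟩ | a <;> simp [circC, invV, basisV]
  · intro b _ hb
    simp [h1, hb.symm]
  · simp

lemma adV_inr_invV (χ : G → G → ℂ) (τ : ℝ) (l : G) :
    adV χ τ (Sum.inr ()) (invV l) = (τ : ℂ)⁻¹ • funV (χ l) := by
  have h1 : ∀ h, circ χ τ (basisV (Sum.inr (Sum.inr h))) (invV l) = 0 := by
    intro h
    rw [invV, circ_basisV]
    funext r
    simp [circC]
  have h2 : ∀ h, circ χ τ (basisV (Sum.inr (Sum.inl h))) (invV l) =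
      χ l h • basisV (Sum.inr (Sum.inl h)) := by
    intro h
    rw [invV, circ_basisV]
    funext r
    simp [circC, basisV]
  have h3 : ∀ h, circ χ τ (basisV (Sum.inr (Sum.inl h))) (basisV (Sum.inr (Sum.inr h))) =
      pointV h := by
    intro h
    rw [circ_basisV]
    funext r
    simp [circC, pointV, basisV]
  simp [adV_inr, h1, h2, h3, funV_eq]

lemma adV_inl_funV (χ : G → G → ℂ) (τ : ℝ) (g : G) (φ : G → ℂ) :
    adV χ τ (Sum.inl g) (funV φ) = funV fun k => φ (k - g) := by
  simp only [funV_eq, map_sum, map_smul, adV_inl_pointV]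
  exact Fintype.sum_equiv (Equiv.addRight g) _ _ (by simp)

lemma adV_inr_funV (χ : G → G → ℂ) (τ : ℝ) (φ : G → ℂ) :
    adV χ τ (Sum.inr ()) (funV φ) = (τ : ℂ) • ∑ g, (∑ k, φ k * (χ g k)⁻¹) • invV g := by
  simp only [funV_eq, map_sum, map_smul, adV_inr_pointV, Finset.smul_sum, Finset.sum_smul,
    smul_smul]
  rw [Finset.sum_comm]
  refine Finset.sum_congr rfl fun g _ => Finset.sum_congr rfl fun k _ => ?_
  ring_nf

/-- `φ` is constant on the cosets of `L`. -/
def CosetInvariant (L : AddSubgroup G) (φ : G → ℂ) : Prop := ∀ l ∈ L, ∀ k, φ (k + l) = φ k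

/-- The spanning vectors `v^0_Y` for `Y ∈ G/L` and `v^l_m` for `l ∈ L^⊥`. -/
def cosetVectors (χ : G → G → ℂ) (L : AddSubgroup G) : Set (TYV G) :=
  {u | ∃ g, u = funV fun k => if k - g ∈ L then 1 else 0} ∪ {u | ∃ l ∈ Lperp G χ L, u = invV l}

lemma cosetInvariant_indicator (L : AddSubgroup G) (g : G) :
    CosetInvariant L fun k => if k - g ∈ L then 1 else 0 := by
  intro l hl k
  have : k + l - g ∈ L ↔ k - g ∈ L := by
    rw [add_sub_right_comm]
    exact L.add_mem_cancel_right hl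
  simp [this]

lemma funV_mem_span (χ : G → G → ℂ) {L : AddSubgroup G} {φ : G → ℂ} (hφ : CosetInvariant L φ) :
    funV φ ∈ Submodule.span ℂ (cosetVectors χ L) := by
  have hL : (Fintype.card L : ℂ) ≠ 0 := by exact_mod_cast Fintype.card_ne_zero
  have h : ∑ g, φ g • (fun k => if k - g ∈ L then (1 : ℂ) else 0) =
      (Fintype.card L : ℂ) • φ := by
    funext k
    rw [Finset.sum_apply]
    have h1 : ∀ g, (φ g • (fun k => if k - g ∈ L then (1 : ℂ) else 0)) k =
        if k - g ∈ L then φ k else 0 := by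
      intro g
      by_cases hg : k - g ∈ L
      · have := hφ _ hg g
        rw [add_sub_cancel] at this
        simp [hg, this]
      · simp [hg]
    rw [Finset.sum_congr rfl fun g _ => h1 g,
      Fintype.sum_equiv (Equiv.subLeft k) _ (fun l => if l ∈ L then φ k else 0) (by simp),
      ← Finset.sum_filter, Finset.sum_const, Pi.smul_apply, smul_eq_mul, nsmul_eq_mul,
      Fintype.card_subtype]
  have h2 : φ = (Fintype.card L : ℂ)⁻¹ •
      ∑ g, φ g • (fun k => if k - g ∈ L then (1 : ℂ) else 0) := by
    rw [h, smul_smul, inv_mul_cancel₀ hL, one_smul]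
  rw [h2, map_smul, map_sum]
  refine Submodule.smul_mem _ _ (Submodule.sum_mem _ fun g _ => ?_)
  rw [map_smul]
  exact Submodule.smul_mem _ _ (Submodule.subset_span (Or.inl ⟨g, rfl⟩))

lemma sum_mul_inv_character_eq_zero {χ : G → G → ℂ} (hsymm : ∀ g h, χ g h = χ h g)
    (hadd : ∀ g g' h, χ (g + g') h = χ g h * χ g' h) {L : AddSubgroup G} {φ : G → ℂ}
    (hφ : CosetInvariant L φ) {g : G} (hg : g ∉ Lperp G χ L) :
    ∑ k, φ k * (χ g k)⁻¹ = 0 := by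
  obtain ⟨l, hl, hne⟩ : ∃ l ∈ L, χ g l ≠ 1 := by simpa [Lperp] using hg
  have h : ∑ k, φ k * (χ g k)⁻¹ = (∑ k, φ k * (χ g k)⁻¹) * (χ g l)⁻¹ := by
    rw [Finset.sum_mul, ← Equiv.sum_comp (Equiv.addRight l)]
    refine Finset.sum_congr rfl fun k _ => ?_
    rw [Equiv.coe_addRight, hφ l hl, hsymm g (k + l), hadd, hsymm k, hsymm l, mul_inv, mul_assoc]
  by_contra h0
  exact hne (inv_eq_one.1 (mul_left_cancel₀ h0 (by rw [← h, mul_one])))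

lemma bCoset_eq_column (Y : Set G) (w : ΩIdx G) :
    bCoset G Y w = column (Sum.inl (0, w)) (funV fun k => if k ∈ Y then 1 else 0) := by
  funext p
  rw [column_apply, funV_apply]
  obtain ⟨⟨a, b⟩, hab⟩ := p
  rcases a with ⟨g, k | k⟩ | a <;> rcases b with ⟨g', b⟩ | b <;> simp only [bCoset]
  · by_cases h1 : g = 0 <;> by_cases h2 : g' = 0 <;> by_cases h3 : b = w <;>
      simp [h1, h2, h3]
  all_goals simp

lemma bM_eq_column (l : G) (w : ΩIdx G) : bM G l w = column (Sum.inl (l, w)) (invV l) := by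
  funext p
  rw [column_apply, invV, basisV]
  obtain ⟨⟨a, b⟩, hab⟩ := p
  rcases a with ⟨g, k | k⟩ | a <;> rcases b with ⟨g', b⟩ | b <;> simp only [bM]
  · simp
  · simp
  · by_cases h1 : g = l <;> by_cases h2 : g' = l <;> by_cases h3 : b = w <;>
      simp [h1, h2, h3]
  all_goals simp

lemma ILTY_eq_columnSpan (χ : G → G → ℂ) (L : AddSubgroup G) :
    ILTY G χ L = columnSpan (cosetVectors χ L) := by
  refine le_antisymm (Submodule.span_le.2 ?_) (Submodule.span_le.2 ?_)
  · rintro _ (⟨g, w, rfl⟩ | ⟨l, hl, w, rfl⟩)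
    · rw [bCoset_eq_column]
      exact Submodule.subset_span ⟨_, Or.inl ⟨g, rfl⟩, _, rfl⟩
    · rw [bM_eq_column]
      exact Submodule.subset_span ⟨_, Or.inr ⟨l, hl, rfl⟩, _, rfl⟩
  · rintro _ ⟨_, ⟨g, rfl⟩ | ⟨l, hl, rfl⟩, β, rfl⟩
    · refine column_induction (homog_funV _) (p := fun b => b ∈ ILTY G χ L)
        (Submodule.zero_mem _) (fun w => ?_) β
      exact Submodule.subset_span (Or.inl ⟨g, w, (bCoset_eq_column _ _).symm⟩)
    · refine column_induction (homog_invV _) (p := fun b => b ∈ ILTY G χ L)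
        (Submodule.zero_mem _) (fun w => ?_) β
      exact Submodule.subset_span (Or.inr ⟨l, hl, w, (bM_eq_column _ _).symm⟩)

lemma homog_cosetVectors (χ : G → G → ℂ) (L : AddSubgroup G) :
    ∀ u ∈ cosetVectors χ L, ∃ l, Homog u (Sum.inl l) := by
  rintro _ (⟨g, rfl⟩ | ⟨l, -, rfl⟩)
  · exact ⟨0, homog_funV _⟩
  · exact ⟨l, homog_invV l⟩

lemma character_zero {χ : G → G → ℂ} (hadd : ∀ g g' h, χ (g + g') h = χ g h * χ g' h)
    (hne : ∀ g h, χ g h ≠ 0) (h : G) : χ 0 h = 1 := by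
  have := hadd 0 0 h
  rw [add_zero] at this
  exact (mul_eq_left₀ (hne 0 h)).1 this.symm

theorem ILTY_isCoideal {χ : G → G → ℂ} (τ : ℝ)
    (hadd : ∀ g g' h, χ (g + g') h = χ g h * χ g' h) (hne : ∀ g h, χ g h ≠ 0)
    (L : AddSubgroup G) : IsCoidealTY G χ τ (ILTY G χ L) := by
  have h0 : ∀ h, χ 0 h = 1 := character_zero hadd hne
  have hinv : ∀ l ∈ Lperp G χ L, invV l ∈ Submodule.span ℂ (cosetVectors χ L) :=
    fun l hl => Submodule.subset_span (Or.inr ⟨l, hl, rfl⟩)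
  rw [ILTY_eq_columnSpan]
  refine isCoidealTY_columnSpan χ τ (homog_cosetVectors χ L) ?_ ?_ ?_
  · rw [unitV_eq]
    exact Submodule.add_mem _ (funV_mem_span χ fun l _ k => rfl) (hinv 0 fun l _ => h0 l)
  · rintro _ (⟨g, rfl⟩ | ⟨l, hl, rfl⟩) _ (⟨g', rfl⟩ | ⟨l', hl', rfl⟩)
    · rw [circ_funV]
      refine funV_mem_span χ fun l hl k => ?_
      simp only [Pi.mul_apply, cosetInvariant_indicator L g l hl k,
        cosetInvariant_indicator L g' l hl k]
    · rw [circ_funV_invV]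
      exact Submodule.zero_mem _
    · rw [circ_invV_funV]
      exact Submodule.zero_mem _
    · rw [circ_invV]
      exact hinv _ fun k hk => by rw [hadd, hl k hk, hl' k hk, one_mul]
  · rintro _ (⟨g, rfl⟩ | ⟨l, hl, rfl⟩)
    · rw [starV_funV]
      refine funV_mem_span χ fun l hl k => ?_
      simp only [cosetInvariant_indicator L g l hl k]
    · rw [starV_invV]
      refine hinv _ fun k hk => ?_
      have := hadd l (-l) k
      rwa [add_neg_cancel, h0, hl k hk, one_mul, eq_comm] at this

theorem ILTY_isInvariant {χ : G → G → ℂ} {τ : ℝ} (hτ : τ ≠ 0) (hsymm : ∀ g h, χ g h = χ h g)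
    (hadd : ∀ g g' h, χ (g + g') h = χ g h * χ g' h)
    (L : AddSubgroup G) : IsInvariantTY G χ τ (ILTY G χ L) := by
  rw [ILTY_eq_columnSpan]
  refine isInvariantTY_columnSpan χ hτ (homog_cosetVectors χ L) ?_ ?_
  · rintro _ (⟨g, rfl⟩ | ⟨l, hl, rfl⟩) (x | ⟨⟩)
    · rw [adV_inl_funV]
      refine funV_mem_span χ fun l hl k => ?_
      rw [add_sub_right_comm]
      exact cosetInvariant_indicator L g l hl (k - x)
    · rw [adV_inr_funV]
      refine Submodule.smul_mem _ _ (Submodule.sum_mem _ fun l _ => ?_)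
      by_cases hl : l ∈ Lperp G χ L
      · exact Submodule.smul_mem _ _ (Submodule.subset_span (Or.inr ⟨l, hl, rfl⟩))
      · rw [sum_mul_inv_character_eq_zero hsymm hadd (cosetInvariant_indicator L g) hl, zero_smul]
        exact Submodule.zero_mem _
    · rw [adV_inl_invV]
      exact Submodule.subset_span (Or.inr ⟨l, hl, rfl⟩)
    · rw [adV_inr_invV]
      refine Submodule.smul_mem _ _ (funV_mem_span χ fun k hk h => ?_)
      rw [hsymm, hadd, hsymm k, hl k hk, mul_one, hsymm]
  · rintro _ (⟨g, rfl⟩ | ⟨l, hl, rfl⟩)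
    · simp [adV_inl_funV]
    · exact adV_inl_invV ..

lemma homog_unitV : Homog (unitV : TYV G) (Sum.inl 0) := by
  rintro (⟨g, a⟩ | a) ha <;> simp_all [unitV, tyGrade]

lemma εTY_column (β : VIdx G) (u : TYV G) : εTY G (column β u) = u β := by
  rw [εTY, Finset.sum_eq_single (⟨(β, β), rfl⟩ : BIdx G)]
  · simp [column_apply]
  · rintro ⟨⟨a, b⟩, hab⟩ _ hne
    by_cases h1 : b = β
    · have h2 : a ≠ b := by
        rintro rfl
        exact hne (by simp [h1])
      simp [h2]
    · simp [column_apply, h1]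
  · simp

lemma εTY_sum_smul {ι : Type*} (s : Finset ι) (c : ι → ℂ) (f : ι → TYB G) :
    εTY G (∑ i ∈ s, c i • f i) = ∑ i ∈ s, c i * εTY G (f i) := by
  simp only [εTY, Finset.sum_apply, Pi.smul_apply, smul_eq_mul, Finset.sum_mul, Finset.mul_sum]
  rw [Finset.sum_comm]
  simp only [mul_assoc]

lemma ΔTY_oneTY (s r : BIdx G) : ΔTY G (oneTY G) (s, r) = column r.1.1 unitV s := by
  have h : oneTY G s = unitV s.1.1 := by
    rcases s with ⟨⟨⟨g, a⟩ | a, b⟩, hr⟩ <;> rfl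
  rw [ΔTY, column_apply, ← h]
  by_cases hs : s.1.2 = r.1.1
  · rw [Finset.sum_eq_single (⟨(s.1.1, r.1.2), by rw [s.2, hs, r.2]⟩ : BIdx G)]
    · simp only [Δc, hs, and_self, if_true, mul_one]
      rw [h]
      rcases s with ⟨⟨⟨g, a⟩ | a, b⟩, hr⟩ <;> rfl
    · rintro b _ hb
      have : ¬ (s.1.1 = b.1.1 ∧ r.1.2 = b.1.2) := by
        rintro ⟨h1, h2⟩
        exact hb (Subtype.ext (Prod.ext h1.symm h2.symm))
      have : ¬ (s.1.1 = b.1.1 ∧ r.1.2 = b.1.2 ∧ s.1.2 = r.1.1) := fun h => this ⟨h.1, h.2.1⟩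
      simp [Δc, this]
    · simp
  · simp [Δc, hs]

lemma εsTY_eq (χ : G → G → ℂ) (τ : ℝ) (b : TYB G) :
    εsTY G χ τ b =
      ∑ r : BIdx G, εTY G (mulTY G χ τ b (Pi.single r 1)) • column r.1.1 unitV := by
  funext s
  rw [εsTY, Finset.sum_apply]
  refine Finset.sum_congr rfl fun r _ => ?_
  rw [ΔTY_oneTY, Pi.smul_apply, smul_eq_mul, mul_comm]

lemma circC_zero_zero (χ : G → G → ℂ) (τ : ℝ) (w x : ΩIdx G) (δ : VIdx G) :
    circC G χ τ (Sum.inl (0, w)) (Sum.inl (0, x)) δ =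
      if x = w ∧ δ = Sum.inl (0, w) then 1 else 0 := by
  rcases w with w | w <;> simp [circC]

lemma εsTY_single (χ : G → G → ℂ) (τ : ℝ) (w : ΩIdx G) :
    εsTY G χ τ (Pi.single ⟨(Sum.inl (0, w), Sum.inl (0, w)), rfl⟩ 1) =
      column (Sum.inl (0, w)) unitV := by
  have h : ∀ r : BIdx G, εTY G (mulTY G χ τ
      (Pi.single ⟨(Sum.inl (0, w), Sum.inl (0, w)), rfl⟩ 1) (Pi.single r 1)) =
      ∑ δ, star (circC G χ τ (Sum.inl (0, w)) r.1.2 δ) *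
        circC G χ τ (Sum.inl (0, w)) r.1.1 δ := by
    intro r
    rw [← mulLin_apply, single_eq_column, single_eq_column,
      mulLin_column χ τ (homog_basisV _) (r.2 ▸ homog_basisV _), εTY_sum_smul]
    simp only [εTY_column, circ_basisV]
  rw [εsTY_eq, Finset.sum_eq_single ⟨(Sum.inl (0, w), Sum.inl (0, w)), rfl⟩]
  · rw [h]
    simp only [circC_zero_zero, true_and]
    rw [Finset.sum_eq_single (Sum.inl (0, w))]
    · simp
    · intro b _ hb
      simp [hb]
    · simp
  · rintro ⟨⟨a, b⟩, hab⟩ _ hne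
    by_cases ha : tyGrade G a = Sum.inl 0
    · rw [h]
      have hb := hab ▸ ha
      rcases a with ⟨g, a⟩ | a
      · rcases b with ⟨g', b⟩ | b
        · obtain rfl : g = 0 := by simpa [tyGrade] using ha
          obtain rfl : g' = 0 := by simpa [tyGrade] using hab.symm
          rw [Finset.sum_eq_zero, zero_smul]
          intro δ _
          simp only [circC_zero_zero]
          by_cases h1 : a = w <;> by_cases h2 : b = w
          · subst h1 h2
            exact absurd rfl hne
          all_goals simp [h1, h2]
        · simp [tyGrade] at hab
      · simp [tyGrade] at ha
    · rw [column_eq_zero homog_unitV ha, smul_zero]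
  · simp

lemma BsTY_eq_columnSpan (χ : G → G → ℂ) (τ : ℝ) :
    BsTY G χ τ = columnSpan {(unitV : TYV G)} := by
  refine le_antisymm (Submodule.span_le.2 ?_) (Submodule.span_le.2 ?_)
  · rintro _ ⟨b, rfl⟩
    rw [εsTY_eq]
    exact Submodule.sum_mem _ fun r _ => Submodule.smul_mem _ _ <|
      Submodule.subset_span ⟨_, rfl, _, rfl⟩
  · rintro _ ⟨_, rfl, β, rfl⟩
    refine column_induction homog_unitV (p := fun b => b ∈ BsTY G χ τ)
      (Submodule.zero_mem _) (fun w => ?_) β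
    exact Submodule.subset_span ⟨_, εsTY_single χ τ w⟩

theorem BsTY_isCoideal (χ : G → G → ℂ) (τ : ℝ) : IsCoidealTY G χ τ (BsTY G χ τ) := by
  have h := Submodule.mem_span_singleton_self (R := ℂ) (unitV : TYV G)
  rw [BsTY_eq_columnSpan]
  refine isCoidealTY_columnSpan χ τ ?_ h ?_ ?_
  · rintro _ rfl
    exact ⟨0, homog_unitV⟩
  · rintro _ rfl _ rfl
    convert h using 1
    simp [unitV_eq, circ_funV, circ_funV_invV, circ_invV_funV, circ_invV]
  · rintro _ rfl
    convert h using 1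
    rw [unitV_eq, starV_add, starV_funV, starV_invV, neg_zero]
    simp [Pi.one_def]

theorem BsTY_isInvariant {χ : G → G → ℂ} {τ : ℝ} (hτ : τ * τ * Fintype.card G = 1)
    (hsymm : ∀ g h, χ g h = χ h g) (hadd : ∀ g g' h, χ (g + g') h = χ g h * χ g' h)
    (hne : ∀ g h, χ g h ≠ 0) (hnondeg : ∀ g, (∀ h, χ g h = 1) → g = 0) :
    IsInvariantTY G χ τ (BsTY G χ τ) := by
  have h0 : ∀ h, χ 0 h = 1 := character_zero hadd hne
  have hτ0 : τ ≠ 0 := by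
    rintro rfl
    simp at hτ
  have hinl : ∀ g, adV χ τ (Sum.inl g) unitV = unitV := by
    intro g
    rw [unitV_eq, map_add, adV_inl_funV, adV_inl_invV]
    rfl
  have hinr : adV χ τ (Sum.inr ()) unitV = (τ : ℂ)⁻¹ • unitV := by
    rw [unitV_eq, map_add, adV_inr_funV, adV_inr_invV, Finset.sum_eq_single 0]
    · have h1 : χ 0 = 1 := funext h0
      have h2 : (τ : ℂ) * Fintype.card G = (τ : ℂ)⁻¹ := by
        refine eq_inv_of_mul_eq_one_left ?_
        rw [mul_right_comm]
        exact_mod_cast hτ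
      simp [h1, smul_smul, h2, add_comm]
    · intro g _ hg
      rw [sum_mul_inv_character_eq_zero hsymm hadd (L := ⊤) (fun _ _ _ => rfl), zero_smul]
      exact fun h => hg (hnondeg g fun k => h k trivial)
    · simp
  rw [BsTY_eq_columnSpan]
  refine isInvariantTY_columnSpan χ hτ0 ?_ ?_ ?_
  · rintro _ rfl
    exact ⟨0, homog_unitV⟩
  · rintro _ rfl (g | ⟨⟩)
    · rw [hinl]
      exact Submodule.mem_span_singleton_self _
    · rw [hinr]
      exact Submodule.smul_mem _ _ (Submodule.mem_span_singleton_self _)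
  · rintro _ rfl
    exact hinl 0

end Columns

/-- each `I^L` (`L ≤ G`) is an invariant coideal of the Tambara–Yamagami
WHA, and so is `B_s` (denoted `I^Ω`). -/
theorem TY_IL_invariant_coideal (G : Type) [AddCommGroup G] [Fintype G] [DecidableEq G]
    (χ : G → G → ℂ) (τ : ℝ)
    (hχsymm : ∀ g h : G, χ g h = χ h g)
    (hχadd : ∀ g g' h : G, χ (g + g') h = χ g h * χ g' h)
    (hχnorm : ∀ g h : G, ‖χ g h‖ = 1)
    (hχnondeg : ∀ g : G, (∀ h : G, χ g h = 1) → g = 0)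
    (hτ : τ = (Real.sqrt (Fintype.card G))⁻¹ ∨ τ = -(Real.sqrt (Fintype.card G))⁻¹) :
    (∀ L : AddSubgroup G,
      IsCoidealTY G χ τ (ILTY G χ L) ∧ IsInvariantTY G χ τ (ILTY G χ L)) ∧
    (IsCoidealTY G χ τ (BsTY G χ τ) ∧ IsInvariantTY G χ τ (BsTY G χ τ)) := by
  have hne : ∀ g h : G, χ g h ≠ 0 := fun g h => norm_ne_zero_iff.1 (by simp [hχnorm])
  have hτ' : τ * τ * Fintype.card G = 1 := by
    have h0 : (Fintype.card G : ℝ) ≠ 0 := by exact_mod_cast Fintype.card_ne_zero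
    have h1 : τ * τ = (Real.sqrt (Fintype.card G) * Real.sqrt (Fintype.card G))⁻¹ := by
      rcases hτ with rfl | rfl <;> simp only [mul_inv, neg_mul_neg]
    rw [h1, Real.mul_self_sqrt (Nat.cast_nonneg _), inv_mul_cancel₀ h0]
  have hτ0 : τ ≠ 0 := by
    rintro rfl
    simp at hτ'
  exact ⟨fun L => ⟨ILTY_isCoideal τ hχadd hne L, ILTY_isInvariant hτ0 hχsymm hχadd L⟩,
    BsTY_isCoideal χ τ, BsTY_isInvariant hτ' hχsymm hχadd hne hχnondeg⟩

end
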